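/- Let H be an infinite-dimensional separable complex Hilbert space, A a bounded normal operator on H, and g ∈ H. Then the system {Aⁿ g : n ≥ 0} is a frame for H (there exist 0 < c ≤ C with c‖f‖² ≤ ∑_{n=0}^∞ |⟨f, Aⁿ g⟩|² ≤ C‖f‖² for all f ∈ H) if and only if there exist an orthonormal (Hilbert) basis (e_k)_{k∈ℕ} of H and a sequence λ : ℕ → ℂ such that: (i) A e_k = λ_k e_k for every k; (ii) |λ_k| < 1 for every k; (iii) |λ_k| → 1 as k → ∞; (iv) the Carleson condition holds: there exists δ > 0 such that for every n ∈ ℕ and every finite set S ⊆ ℕ with n ∉ S, ∏_{k∈S} |λ_n − λ_k| / |1 − conj(λ_n)·λ_k| ≥ δ; and (v) there exist constants 0 < c' ≤ C' such that c' ≤ |⟨e_k, g⟩| / √(1 − |λ_k|²) ≤ C' for every k. -/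

import Mathlib

open scoped InnerProductSpace


/-- Szegő kernel. -/
noncomputable def ck (a z : ℂ) : ℂ := (1 - (starRingEnd ℂ) a * z)⁻¹
/-- Blaschke factor. -/
noncomputable def bl (a z : ℂ) : ℂ := (z - a) / (1 - (starRingEnd ℂ) a * z)

lemma one_sub_ne {a z : ℂ} (ha : ‖a‖ < 1) (hz : ‖z‖ ≤ 1) : 1 - (starRingEnd ℂ) a * z ≠ 0 := by
  intro h
  have h1 : (starRingEnd ℂ) a * z = 1 := (sub_eq_zero.mp h).symm
  have h2 : ‖a‖ * ‖z‖ = 1 := by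
    have := congrArg norm h1
    simpa using this
  nlinarith [norm_nonneg a, norm_nonneg z]

lemma ck_diff {a z : ℂ} (ha : ‖a‖ < 1) (hz : ‖z‖ ≤ 1) : DifferentiableAt ℂ (ck a) z := by
  unfold ck
  have := one_sub_ne ha hz
  fun_prop (disch := assumption)

lemma bl_diff {a z : ℂ} (ha : ‖a‖ < 1) (hz : ‖z‖ ≤ 1) : DifferentiableAt ℂ (bl a) z := by
  unfold bl
  have := one_sub_ne ha hz
  fun_prop (disch := assumption)

lemma circ_int {E : Type*} [NormedAddCommGroup E] {q : ℂ → E} (hq : ∀ z, ‖z‖ = 1 → ContinuousAt q z) :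
    CircleIntegrable q 0 1 := by
  apply ContinuousOn.circleIntegrable zero_le_one
  intro z hz
  exact (hq z (by simpa using hz)).continuousWithinAt

lemma repro {a : ℂ} (ha : ‖a‖ < 1) {q : ℂ → ℂ} (hq : ∀ z, ‖z‖ ≤ 1 → DifferentiableAt ℂ q z) :
    Real.circleAverage (fun z => (starRingEnd ℂ) (ck a z) * q z) 0 1 = q a := by
  rw [Real.circleAverage_eq_circleIntegral one_ne_zero]
  have h := Complex.two_pi_I_inv_smul_circleIntegral_sub_inv_smul_of_differentiable_on_off_countable
    (R := 1) (c := 0) (w := a) (f := q) Set.countable_empty (by simpa using ha)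
    (fun z hz => (hq z (by simpa using hz)).continuousAt.continuousWithinAt)
    (fun z hz => hq z (by simpa using (Metric.ball_subset_closedBall hz.1)))
  rw [← h]
  congr 1
  apply circleIntegral.integral_congr zero_le_one
  intro z hz
  have hz1 : ‖z‖ = 1 := by simpa using hz
  have hzc : (starRingEnd ℂ) z * z = 1 := by
    rw [Complex.conj_mul', hz1]; simp
  have h0 : z ≠ 0 := by rintro rfl; simp at hz1
  have hza : z - a ≠ 0 := by
    intro h; rw [sub_eq_zero] at h; rw [h] at hz1; linarith
  have h1 := one_sub_ne ha hz1.le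
  have h2 : 1 - a * (starRingEnd ℂ) z ≠ 0 := by
    intro h; apply h1
    have := congrArg (starRingEnd ℂ) h
    simpa using this
  simp only [ck, map_inv₀, map_sub, map_one, map_mul, Complex.conj_conj, sub_zero, smul_eq_mul]
  have h3 : z * (1 - a * (starRingEnd ℂ) z) = z - a := by
    linear_combination (-a) * hzc
  rw [← h3, mul_inv, mul_assoc]

lemma norm_sq_avg {u : ℂ → ℂ} (hu : ∀ z, ‖z‖ = 1 → ContinuousAt u z) :
    ((Real.circleAverage (fun z => ‖u z‖ ^ 2) 0 1 : ℝ) : ℂ) =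
      Real.circleAverage (fun z => (starRingEnd ℂ) (u z) * u z) 0 1 := by
  have h := Complex.ofRealCLM.circleAverage_comp_comm (f := fun z => ‖u z‖ ^ 2) (c := 0) (R := 1)
    (circ_int fun z hz => by have := hu z hz; fun_prop)
  rw [Complex.ofRealCLM_apply] at h
  rw [← h]
  congr 1
  ext z
  simp [Complex.conj_mul']

/-- energy -/
noncomputable def En (S : Finset ℕ) (lam c : ℕ → ℂ) : ℝ :=
  Real.circleAverage (fun z => ‖∑ k ∈ S, c k * ck (lam k) z‖ ^ 2) 0 1

lemma sum_ck_diff {S : Finset ℕ} {lam : ℕ → ℂ} (hl : ∀ k, ‖lam k‖ < 1) (c : ℕ → ℂ) :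
    ∀ z, ‖z‖ ≤ 1 → DifferentiableAt ℂ (fun z => ∑ k ∈ S, c k * ck (lam k) z) z := by
  intro z hz
  have := fun k => ck_diff (hl k) hz
  fun_prop

lemma pair_avg {S : Finset ℕ} {lam : ℕ → ℂ} (hl : ∀ k, ‖lam k‖ < 1) (c : ℕ → ℂ) {q : ℂ → ℂ}
    (hq : ∀ z, ‖z‖ ≤ 1 → DifferentiableAt ℂ q z) :
    Real.circleAverage (fun z => (starRingEnd ℂ) (∑ k ∈ S, c k * ck (lam k) z) * q z) 0 1
      = ∑ k ∈ S, (starRingEnd ℂ) (c k) * q (lam k) := by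
  have h1 : (fun z => (starRingEnd ℂ) (∑ k ∈ S, c k * ck (lam k) z) * q z) =
      fun z => ∑ k ∈ S, (starRingEnd ℂ (c k)) • ((starRingEnd ℂ) (ck (lam k) z) * q z) := by
    ext z
    simp [Finset.sum_mul, mul_assoc]
  rw [h1, Real.circleAverage_fun_sum]
  · refine Finset.sum_congr rfl fun k _ => ?_
    rw [Real.circleAverage_fun_smul, repro (hl k) hq, smul_eq_mul]
  · intro k _
    apply circ_int
    intro z hz
    have h2 := (ck_diff (hl k) hz.le).continuousAt
    have h3 := (hq z hz.le).continuousAt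
    have h4 : ContinuousAt (fun z => (starRingEnd ℂ) (ck (lam k) z)) z :=
      Complex.continuous_conj.continuousAt.comp h2
    simp only [smul_eq_mul]
    exact continuousAt_const.mul (h4.mul h3)

lemma En_eq {S : Finset ℕ} {lam : ℕ → ℂ} (hl : ∀ k, ‖lam k‖ < 1) (c : ℕ → ℂ) :
    (En S lam c : ℂ) = ∑ j ∈ S, (starRingEnd ℂ) (c j) * ∑ k ∈ S, c k * ck (lam k) (lam j) := by
  unfold En
  rw [norm_sq_avg fun z hz => (sum_ck_diff hl c z hz.le).continuousAt,
    pair_avg hl c (sum_ck_diff hl c)]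

lemma En_hasSum {S : Finset ℕ} {lam : ℕ → ℂ} (hl : ∀ k, ‖lam k‖ < 1) (c : ℕ → ℂ) :
    HasSum (fun n : ℕ => ‖∑ k ∈ S, c k * (starRingEnd ℂ) (lam k) ^ n‖ ^ 2) (En S lam c) := by
  rw [← Complex.hasSum_ofReal, En_eq hl]
  have h1 : (fun n : ℕ => ((‖∑ k ∈ S, c k * (starRingEnd ℂ) (lam k) ^ n‖ ^ 2 : ℝ) : ℂ)) =
      fun n : ℕ => ∑ j ∈ S, (starRingEnd ℂ) (c j) * ∑ k ∈ S, c k *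
        ((starRingEnd ℂ) (lam k) * lam j) ^ n := by
    ext n
    push_cast
    rw [← Complex.conj_mul']
    simp only [map_sum, map_mul, map_pow, Complex.conj_conj, Finset.sum_mul, Finset.mul_sum]
    rw [Finset.sum_comm]
    refine Finset.sum_congr rfl fun j _ => Finset.sum_congr rfl fun k _ => ?_
    ring
  rw [h1]
  refine hasSum_sum fun j _ => HasSum.mul_left _ (hasSum_sum fun k _ => HasSum.mul_left _ ?_)
  unfold ck
  apply hasSum_geometric_of_norm_lt_one
  rw [norm_mul, RCLike.norm_conj]
  nlinarith [norm_nonneg (lam k), norm_nonneg (lam j), hl k, hl j]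

lemma En_mult {S : Finset ℕ} {lam : ℕ → ℂ} (hl : ∀ k, ‖lam k‖ < 1) (c : ℕ → ℂ) {f : ℂ → ℂ} {M : ℝ}
    (hf : ∀ z, ‖z‖ ≤ 1 → DifferentiableAt ℂ f z) (hM : ∀ z, ‖z‖ = 1 → ‖f z‖ ≤ M) :
    En S lam (fun k => (starRingEnd ℂ) (f (lam k)) * c k) ≤ M ^ 2 * En S lam c := by
  set c' : ℕ → ℂ := fun k => (starRingEnd ℂ) (f (lam k)) * c k with hc'
  set h := fun z => ∑ k ∈ S, c k * ck (lam k) z with hh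
  set h' := fun z => ∑ k ∈ S, c' k * ck (lam k) z with hh'
  have dh := sum_ck_diff (S := S) hl c
  have dh' := sum_ck_diff (S := S) hl c'
  have key : (En S lam c' : ℂ) = Real.circleAverage (fun z => (starRingEnd ℂ) (h z) * (f z * h' z)) 0 1 := by
    have h0 := pair_avg (S := S) hl c (q := fun z => f z * h' z)
      (fun z hz => (hf z hz).mul (dh' z hz))
    refine Eq.trans ?_ h0.symm
    unfold En
    rw [norm_sq_avg fun z hz => (dh' z hz.le).continuousAt, pair_avg hl c' dh']
    refine Finset.sum_congr rfl fun k _ => ?_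
    simp [hc']; ring
  have ci : CircleIntegrable (fun z => (starRingEnd ℂ) (h z) * (f z * h' z)) 0 1 := by
    apply circ_int
    intro z hz
    have h4 : ContinuousAt (fun z => (starRingEnd ℂ) (h z)) z :=
      Complex.continuous_conj.continuousAt.comp (dh z hz.le).continuousAt
    exact h4.mul ((hf z hz.le).continuousAt.mul (dh' z hz.le).continuousAt)
  have hre := Complex.reCLM.circleAverage_comp_comm ci
  rw [← key, Complex.reCLM_apply, Complex.ofReal_re] at hre
  have i1 : CircleIntegrable (fun z => ‖h z‖ ^ 2) 0 1 := circ_int fun z hz => by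
    have := (dh z hz.le).continuousAt
    exact this.norm.pow 2
  have i2 : CircleIntegrable (fun z => ‖h' z‖ ^ 2) 0 1 := circ_int fun z hz => by
    have := (dh' z hz.le).continuousAt
    exact this.norm.pow 2
  have hle : Real.circleAverage (Complex.reCLM ∘ fun z => (starRingEnd ℂ) (h z) * (f z * h' z)) 0 1 ≤
      Real.circleAverage (fun z => (M ^ 2 / 2) • ‖h z‖ ^ 2 + (1 / 2 : ℝ) • ‖h' z‖ ^ 2) 0 1 := by
    apply Real.circleAverage_mono
    · apply circ_int
      intro z hz
      have h4 : ContinuousAt (fun z => (starRingEnd ℂ) (h z)) z :=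
        Complex.continuous_conj.continuousAt.comp (dh z hz.le).continuousAt
      exact Complex.reCLM.continuous.continuousAt.comp
        (h4.mul ((hf z hz.le).continuousAt.mul (dh' z hz.le).continuousAt))
    · exact (i1.const_smul).add (i2.const_smul)
    · intro z hz
      have hz1 : ‖z‖ = 1 := by simpa using hz
      have := hM z hz1
      simp only [Function.comp, Complex.reCLM_apply, smul_eq_mul]
      refine (Complex.re_le_norm _).trans ?_
      rw [norm_mul, norm_mul, RCLike.norm_conj]
      have h5 : ‖h z‖ * (‖f z‖ * ‖h' z‖) ≤ ‖h z‖ * (M * ‖h' z‖) := by gcongr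
      nlinarith [sq_nonneg (M * ‖h z‖ - ‖h' z‖)]
  rw [hre, Real.circleAverage_fun_add (f₁ := fun z => (M ^ 2 / 2) • ‖h z‖ ^ 2)
    (f₂ := fun z => (1 / 2 : ℝ) • ‖h' z‖ ^ 2) (i1.const_smul) (i2.const_smul), Real.circleAverage_fun_smul,
    Real.circleAverage_fun_smul] at hle
  change En S lam c' ≤ (M^2/2) * En S lam c + (1/2) * En S lam c' at hle
  linarith


lemma tele (P : Finset ℕ) (r t : ℕ → ℝ) (ht : ∀ k, 0 ≤ t k) :
    ∑ j ∈ P, t j * Real.exp (-∑ k ∈ P.filter (fun k => r j ≤ r k), t k)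
      ≤ 1 - Real.exp (-∑ k ∈ P, t k) := by
  classical
  induction P using Finset.induction_on_min_value r with
  | empty => simp
  | insert a s ha hmin ih =>
    rw [Finset.sum_insert ha, Finset.sum_insert ha]
    have h1 : (insert a s).filter (fun k => r a ≤ r k) = insert a s := by
      apply Finset.filter_true_of_mem
      intro x hx
      rcases Finset.mem_insert.mp hx with rfl | hx
      · exact le_rfl
      · exact hmin x hx
    rw [h1, Finset.sum_insert ha]
    have h2 : ∑ j ∈ s, t j * Real.exp (-∑ k ∈ (insert a s).filter (fun k => r j ≤ r k), t k) ≤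
        ∑ j ∈ s, t j * Real.exp (-∑ k ∈ s.filter (fun k => r j ≤ r k), t k) := by
      refine Finset.sum_le_sum fun j _ => mul_le_mul_of_nonneg_left ?_ (ht j)
      rw [Real.exp_le_exp, neg_le_neg_iff]
      exact Finset.sum_le_sum_of_subset_of_nonneg
        (Finset.filter_subset_filter _ (Finset.subset_insert _ _)) (fun k _ _ => ht k)
    have h3 : Real.exp (-∑ k ∈ s, t k) = Real.exp (t a) * Real.exp (-(t a + ∑ k ∈ s, t k)) := by
      rw [← Real.exp_add]; congr 1; ring
    have h4 := Real.add_one_le_exp (t a)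
    have h5 := Real.exp_pos (-(t a + ∑ k ∈ s, t k))
    nlinarith

lemma bl_norm_sq {a z : ℂ} (ha : ‖a‖ < 1) (hz : ‖z‖ ≤ 1) :
    1 - ‖bl a z‖ ^ 2 = (1 - ‖a‖ ^ 2) * (1 - ‖z‖ ^ 2) / ‖1 - (starRingEnd ℂ) a * z‖ ^ 2 := by
  have h0 := one_sub_ne ha hz
  have h1 : ‖1 - (starRingEnd ℂ) a * z‖ ^ 2 ≠ 0 := by simpa using h0
  rw [bl, norm_div, div_pow, eq_div_iff h1, sub_mul, div_mul_cancel₀ _ h1]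
  simp only [← Complex.normSq_eq_norm_sq, Complex.normSq_apply]
  simp
  ring

lemma ck_re {a z : ℂ} (ha : ‖a‖ < 1) (hz : ‖z‖ ≤ 1) :
    (ck a z).re = 1 / 2 + (1 - ‖a‖ ^ 2 * ‖z‖ ^ 2) / (2 * ‖1 - (starRingEnd ℂ) a * z‖ ^ 2) := by
  have h0 := one_sub_ne ha hz
  have h1 : ‖1 - (starRingEnd ℂ) a * z‖ ^ 2 ≠ 0 := by simpa using h0
  rw [ck, Complex.inv_re, Complex.normSq_eq_norm_sq]
  field_simp
  simp only [← Complex.normSq_eq_norm_sq, Complex.normSq_apply]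
  simp
  ring

lemma bl_le_one {a z : ℂ} (ha : ‖a‖ < 1) (hz : ‖z‖ ≤ 1) : ‖bl a z‖ ≤ 1 := by
  have h := bl_norm_sq ha hz
  have h1 : 0 ≤ (1 - ‖a‖ ^ 2) * (1 - ‖z‖ ^ 2) / ‖1 - (starRingEnd ℂ) a * z‖ ^ 2 := by
    apply div_nonneg _ (by positivity)
    apply mul_nonneg <;> nlinarith [norm_nonneg a, norm_nonneg z]
  nlinarith [norm_nonneg (bl a z)]

lemma bl_eq_one {a z : ℂ} (ha : ‖a‖ < 1) (hz : ‖z‖ = 1) : ‖bl a z‖ = 1 := by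
  have h := bl_norm_sq ha hz.le
  rw [hz] at h
  have : ‖bl a z‖ ^ 2 = 1 := by simp at h; linarith
  nlinarith [norm_nonneg (bl a z)]

lemma exp_prod_le (S : Finset ℕ) (x : ℕ → ℝ) :
    Real.exp (∑ k ∈ S, (1 - x k ^ 2)) * (∏ k ∈ S, x k) ^ 2 ≤ 1 := by
  rw [Real.exp_sum, ← Finset.prod_pow, ← Finset.prod_mul_distrib]
  apply Finset.prod_le_one
  · intro k _; positivity
  · intro k _
    have h := Real.add_one_le_exp (x k ^ 2 - 1)
    have h2 : Real.exp (1 - x k ^ 2) * Real.exp (x k ^ 2 - 1) = 1 := by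
      rw [← Real.exp_add]; simp
    have h3 := Real.exp_pos (1 - x k ^ 2)
    nlinarith

/-- Building block of the Jones interpolation formula. -/
noncomputable def jones (P : Finset ℕ) (lam : ℕ → ℂ) (j : ℕ) (z : ℂ) : ℂ :=
  (∏ k ∈ P.erase j, bl (lam k) z / bl (lam k) (lam j)) *
  ((1 - ‖lam j‖ ^ 2 : ℝ) * ck (lam j) z) ^ 2 *
  Complex.exp (-∑ k ∈ P.filter (fun k => ‖lam j‖ ≤ ‖lam k‖),
    (1 - ‖lam k‖ ^ 2 : ℝ) * (ck (lam k) z - ck (lam k) (lam j)))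

lemma jones_diff (P : Finset ℕ) {lam : ℕ → ℂ} (hl : ∀ k, ‖lam k‖ < 1) (j : ℕ) {z : ℂ}
    (hz : ‖z‖ ≤ 1) : DifferentiableAt ℂ (jones P lam j) z := by
  have h1 := fun k => ck_diff (hl k) hz
  have h2 := fun k => bl_diff (hl k) hz
  unfold jones
  simp only [div_eq_mul_inv]
  fun_prop

lemma bl_self (a : ℂ) : bl a a = 0 := by simp [bl]

lemma ck_self {a : ℂ} (ha : ‖a‖ < 1) : ((1 - ‖a‖ ^ 2 : ℝ) : ℂ) * ck a a = 1 := by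
  have h := one_sub_ne ha ha.le
  have h2 : ((1 - ‖a‖ ^ 2 : ℝ) : ℂ) = 1 - (starRingEnd ℂ) a * a := by
    rw [Complex.conj_mul']; push_cast; ring
  rw [ck, h2, mul_inv_cancel₀ h]

lemma jones_self (P : Finset ℕ) {lam : ℕ → ℂ} (hl : ∀ k, ‖lam k‖ < 1) (j : ℕ)
    (hne : ∀ k, k ≠ j → bl (lam k) (lam j) ≠ 0) : jones P lam j (lam j) = 1 := by
  unfold jones
  rw [ck_self (hl j)]
  rw [Finset.prod_eq_one]
  · simp
  · intro k hk
    exact div_self (hne k (Finset.ne_of_mem_erase hk))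

lemma jones_other (P : Finset ℕ) {lam : ℕ → ℂ} (j i : ℕ) (hi : i ∈ P) (hij : i ≠ j) :
    jones P lam j (lam i) = 0 := by
  unfold jones
  rw [Finset.prod_eq_zero (Finset.mem_erase.mpr ⟨hij, hi⟩)]
  · simp
  · simp [bl_self]

lemma jones_bound (P : Finset ℕ) {lam : ℕ → ℂ} (hl : ∀ k, ‖lam k‖ < 1) {δ : ℝ} (hδ : 0 < δ)
    (hC : ∀ (n : ℕ) (S : Finset ℕ), n ∉ S → δ ≤ ∏ k ∈ S, ‖bl (lam k) (lam n)‖)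
    {j : ℕ} (hj : j ∈ P) {z : ℂ} (hz : ‖z‖ ≤ 1) :
    ‖jones P lam j z‖ ≤ 2 * Real.exp 1 / δ ^ 3 *
      (((1 - ‖lam j‖ ^ 2) ^ 2 * ‖ck (lam j) z‖ ^ 2 / 2) *
        Real.exp (-∑ k ∈ P.filter (fun k => ‖lam j‖ ≤ ‖lam k‖),
          (1 - ‖lam k‖ ^ 2) ^ 2 * ‖ck (lam k) z‖ ^ 2 / 2)) := by
  have hprod := hC j (P.erase j) (by simp)
  have hw : ∀ k, 0 < 1 - ‖lam k‖ ^ 2 := fun k => by nlinarith [hl k, norm_nonneg (lam k)]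
  have h1 : ‖∏ k ∈ P.erase j, bl (lam k) z / bl (lam k) (lam j)‖ ≤ 1 / δ := by
    rw [Finset.prod_div_distrib, norm_div, norm_prod, norm_prod]
    apply div_le_div₀ zero_le_one _ hδ hprod
    exact Finset.prod_le_one (fun _ _ => norm_nonneg _) (fun k _ => bl_le_one (hl k) hz)
  have h2 : ‖((1 - ‖lam j‖ ^ 2 : ℝ) * ck (lam j) z) ^ 2‖ = (1 - ‖lam j‖ ^ 2) ^ 2 * ‖ck (lam j) z‖ ^ 2 := by
    rw [norm_pow, norm_mul, Complex.norm_real, Real.norm_of_nonneg (hw j).le, mul_pow]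
  have h3 : ‖Complex.exp (-∑ k ∈ P.filter (fun k => ‖lam j‖ ≤ ‖lam k‖),
      (1 - ‖lam k‖ ^ 2 : ℝ) * (ck (lam k) z - ck (lam k) (lam j)))‖ ≤
      Real.exp (-∑ k ∈ P.filter (fun k => ‖lam j‖ ≤ ‖lam k‖),
          (1 - ‖lam k‖ ^ 2) ^ 2 * ‖ck (lam k) z‖ ^ 2 / 2) * (Real.exp 1 / δ ^ 2) := by
    rw [Complex.norm_exp]
    have h4 : (-∑ k ∈ P.filter (fun k => ‖lam j‖ ≤ ‖lam k‖),
      ((1 - ‖lam k‖ ^ 2 : ℝ) : ℂ) * (ck (lam k) z - ck (lam k) (lam j))).re ≤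
      (-∑ k ∈ P.filter (fun k => ‖lam j‖ ≤ ‖lam k‖),
          (1 - ‖lam k‖ ^ 2) ^ 2 * ‖ck (lam k) z‖ ^ 2 / 2) +
        ∑ k ∈ P.filter (fun k => ‖lam j‖ ≤ ‖lam k‖), (1 - ‖bl (lam k) (lam j)‖ ^ 2) := by
      rw [Complex.neg_re, Complex.re_sum, ← Finset.sum_neg_distrib, ← Finset.sum_neg_distrib,
        ← Finset.sum_add_distrib]
      refine Finset.sum_le_sum fun k hk => ?_
      have hk' := (Finset.mem_filter.mp hk).2
      rw [Complex.re_ofReal_mul, Complex.sub_re, ck_re (hl k) hz, ck_re (hl k) (hl j).le,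
        bl_norm_sq (hl k) (hl j).le]
      have e1 : ‖ck (lam k) z‖ ^ 2 = 1 / ‖1 - (starRingEnd ℂ) (lam k) * z‖ ^ 2 := by
        rw [ck, norm_inv, inv_pow, one_div]
      rw [e1]
      have p1 : 0 < ‖1 - (starRingEnd ℂ) (lam k) * z‖ ^ 2 := by
        have := one_sub_ne (hl k) hz
        positivity
      have p2 : 0 < ‖1 - (starRingEnd ℂ) (lam k) * lam j‖ ^ 2 := by
        have := one_sub_ne (hl k) (hl j).le
        positivity
      generalize ‖1 - (starRingEnd ℂ) (lam k) * z‖ ^ 2 = X at p1 ⊢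
      generalize ‖1 - (starRingEnd ℂ) (lam k) * lam j‖ ^ 2 = Y at p2 ⊢
      have q1 : (1 - ‖lam k‖ ^ 2) / (2 * X) ≤ (1 - ‖lam k‖ ^ 2 * ‖z‖ ^ 2) / (2 * X) := by
        gcongr
        have : ‖z‖ ^ 2 ≤ 1 := by nlinarith [norm_nonneg z]
        nlinarith [sq_nonneg ‖lam k‖]
      have q2 : (1 - ‖lam k‖ ^ 2 * ‖lam j‖ ^ 2) / (2 * Y) ≤ (2 * (1 - ‖lam j‖ ^ 2)) / (2 * Y) := by
        gcongr
        have : ‖lam j‖ ^ 2 ≤ ‖lam k‖ ^ 2 := by gcongr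
        nlinarith [sq_nonneg ‖lam j‖, hw j]
      have e2 : (1 - ‖lam k‖ ^ 2) ^ 2 * (1 / X) / 2 = (1 - ‖lam k‖ ^ 2) * ((1 - ‖lam k‖ ^ 2) / (2 * X)) := by
        field_simp
      have e3 : (1 - ‖lam k‖ ^ 2) * (1 - ‖lam j‖ ^ 2) / Y =
          (1 - ‖lam k‖ ^ 2) * ((2 * (1 - ‖lam j‖ ^ 2)) / (2 * Y)) := by
        field_simp
      rw [e2, e3]
      have := hw k
      nlinarith
    have h5 : ∑ k ∈ P.filter (fun k => ‖lam j‖ ≤ ‖lam k‖), (1 - ‖bl (lam k) (lam j)‖ ^ 2) ≤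
        1 + ∑ k ∈ P.erase j, (1 - ‖bl (lam k) (lam j)‖ ^ 2) := by
      have : 1 + ∑ k ∈ P.erase j, (1 - ‖bl (lam k) (lam j)‖ ^ 2) =
          ∑ k ∈ P, (1 - ‖bl (lam k) (lam j)‖ ^ 2) := by
        rw [← Finset.add_sum_erase P _ hj, bl_self]; simp
      rw [this]
      apply Finset.sum_le_sum_of_subset_of_nonneg (Finset.filter_subset _ _)
      intro k _ _
      have := bl_le_one (hl k) (hl j).le
      nlinarith [norm_nonneg (bl (lam k) (lam j))]
    have h6 : Real.exp (∑ k ∈ P.erase j, (1 - ‖bl (lam k) (lam j)‖ ^ 2)) ≤ 1 / δ ^ 2 := by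
      have := exp_prod_le (P.erase j) (fun k => ‖bl (lam k) (lam j)‖)
      rw [le_div_iff₀ (by positivity)]
      refine le_trans ?_ this
      gcongr
    calc _ ≤ Real.exp ((-∑ k ∈ P.filter (fun k => ‖lam j‖ ≤ ‖lam k‖),
          (1 - ‖lam k‖ ^ 2) ^ 2 * ‖ck (lam k) z‖ ^ 2 / 2) +
          (1 + ∑ k ∈ P.erase j, (1 - ‖bl (lam k) (lam j)‖ ^ 2))) := by
            rw [Real.exp_le_exp]; linarith
      _ ≤ _ := by
        rw [Real.exp_add, Real.exp_add]
        have : Real.exp 1 / δ ^ 2 = Real.exp 1 * (1 / δ ^ 2) := by ring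
        rw [this]
        gcongr
  rw [jones, norm_mul, norm_mul, h2]
  calc _ ≤ 1 / δ * ((1 - ‖lam j‖ ^ 2) ^ 2 * ‖ck (lam j) z‖ ^ 2) *
        (Real.exp (-∑ k ∈ P.filter (fun k => ‖lam j‖ ≤ ‖lam k‖),
          (1 - ‖lam k‖ ^ 2) ^ 2 * ‖ck (lam k) z‖ ^ 2 / 2) * (Real.exp 1 / δ ^ 2)) := by
        gcongr
    _ = _ := by
        field_simp

lemma jones_interp (P : Finset ℕ) {lam : ℕ → ℂ} (hl : ∀ k, ‖lam k‖ < 1) {δ : ℝ} (hδ : 0 < δ)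
    (hC : ∀ (n : ℕ) (S : Finset ℕ), n ∉ S → δ ≤ ∏ k ∈ S, ‖bl (lam k) (lam n)‖)
    (ε : ℕ → ℂ) (hε : ∀ k, ‖ε k‖ ≤ 1) :
    ∃ f : ℂ → ℂ, (∀ z, ‖z‖ ≤ 1 → DifferentiableAt ℂ f z) ∧ (∀ k ∈ P, f (lam k) = ε k) ∧
      ∀ z, ‖z‖ ≤ 1 → ‖f z‖ ≤ 2 * Real.exp 1 / δ ^ 3 := by
  refine ⟨fun z => ∑ j ∈ P, ε j * jones P lam j z, ?_, ?_, ?_⟩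
  · intro z hz
    have := fun j => jones_diff P hl j hz
    fun_prop
  · intro k hk
    have hne : ∀ i, i ≠ k → bl (lam i) (lam k) ≠ 0 := by
      intro i hi h0
      have := hC k {i} (by simpa using hi.symm)
      simp [h0] at this
      linarith
    simp only
    rw [Finset.sum_eq_single k]
    · rw [jones_self P hl k hne, mul_one]
    · intro j _ hjk
      rw [jones_other P j k hk hjk.symm, mul_zero]
    · intro h; exact absurd hk h
  · intro z hz
    calc ‖∑ j ∈ P, ε j * jones P lam j z‖ ≤ ∑ j ∈ P, ‖ε j * jones P lam j z‖ := norm_sum_le _ _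
      _ ≤ ∑ j ∈ P, 2 * Real.exp 1 / δ ^ 3 *
      (((1 - ‖lam j‖ ^ 2) ^ 2 * ‖ck (lam j) z‖ ^ 2 / 2) *
        Real.exp (-∑ k ∈ P.filter (fun k => ‖lam j‖ ≤ ‖lam k‖),
          (1 - ‖lam k‖ ^ 2) ^ 2 * ‖ck (lam k) z‖ ^ 2 / 2)) := by
          refine Finset.sum_le_sum fun j hj => ?_
          rw [norm_mul]
          refine le_trans ?_ (jones_bound P hl hδ hC hj hz)
          exact mul_le_of_le_one_left (norm_nonneg _) (hε j)
      _ ≤ 2 * Real.exp 1 / δ ^ 3 * 1 := by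
          rw [← Finset.mul_sum]
          gcongr
          have := tele P (fun k => ‖lam k‖) (fun k => (1 - ‖lam k‖ ^ 2) ^ 2 * ‖ck (lam k) z‖ ^ 2 / 2)
            (fun k => by positivity)
          have h2 := Real.exp_pos (-∑ k ∈ P, (1 - ‖lam k‖ ^ 2) ^ 2 * ‖ck (lam k) z‖ ^ 2 / 2)
          linarith
      _ = _ := mul_one _


lemma par_avg {u v : ℂ → ℂ} (hu : ∀ z, ‖z‖ = 1 → ContinuousAt u z)
    (hv : ∀ z, ‖z‖ = 1 → ContinuousAt v z) :
    Real.circleAverage (fun z => ‖u z + v z‖ ^ 2) 0 1 + Real.circleAverage (fun z => ‖u z - v z‖ ^ 2) 0 1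
    = 2 * (Real.circleAverage (fun z => ‖u z‖ ^ 2) 0 1 + Real.circleAverage (fun z => ‖v z‖ ^ 2) 0 1) := by
  have i1 : CircleIntegrable (fun z => ‖u z + v z‖ ^ 2) 0 1 := circ_int fun z hz =>
    (((hu z hz).add (hv z hz)).norm.pow 2)
  have i2 : CircleIntegrable (fun z => ‖u z - v z‖ ^ 2) 0 1 := circ_int fun z hz =>
    (((hu z hz).sub (hv z hz)).norm.pow 2)
  have i3 : CircleIntegrable (fun z => ‖u z‖ ^ 2) 0 1 := circ_int fun z hz => (hu z hz).norm.pow 2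
  have i4 : CircleIntegrable (fun z => ‖v z‖ ^ 2) 0 1 := circ_int fun z hz => (hv z hz).norm.pow 2
  rw [← Real.circleAverage_fun_add i1 i2, ← Real.circleAverage_fun_add i3 i4, ← smul_eq_mul,
    ← Real.circleAverage_fun_smul]
  congr 1
  ext z
  have := parallelogram_law_with_norm ℂ (u z) (v z)
  simp only [smul_eq_mul]
  nlinarith

lemma cont_sum {S : Finset ℕ} {u : ℕ → ℂ → ℂ} (hu : ∀ k z, ‖z‖ = 1 → ContinuousAt (u k) z)
    (ε : ℕ → ℂ) : ∀ z, ‖z‖ = 1 → ContinuousAt (fun z => ∑ k ∈ S, ε k * u k z) z := by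
  intro z hz
  have := fun k => hu k z hz
  fun_prop

lemma sgn_le (S : Finset ℕ) {u : ℕ → ℂ → ℂ} (hu : ∀ k z, ‖z‖ = 1 → ContinuousAt (u k) z) :
    ∃ ε : ℕ → ℂ, (∀ k, ε k = 1 ∨ ε k = -1) ∧
      Real.circleAverage (fun z => ‖∑ k ∈ S, ε k * u k z‖ ^ 2) 0 1 ≤
        ∑ k ∈ S, Real.circleAverage (fun z => ‖u k z‖ ^ 2) 0 1 := by
  classical
  induction S using Finset.induction_on with
  | empty => exact ⟨fun _ => 1, fun _ => Or.inl rfl, by simp [Real.circleAverage_const]⟩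
  | insert a s ha ih =>
    obtain ⟨ε, hε, h⟩ := ih
    have hp := par_avg (u := u a) (v := fun z => ∑ k ∈ s, ε k * u k z) (hu a) (cont_sum hu ε)
    rw [Finset.sum_insert ha]
    have key : ∀ η : ℂ, (fun z => ‖∑ k ∈ insert a s, (if k = a then 1 else η * ε k) * u k z‖ ^ 2) =
        fun z => ‖u a z + η * ∑ k ∈ s, ε k * u k z‖ ^ 2 := by
      intro η
      ext z
      rw [Finset.sum_insert ha, if_pos rfl, one_mul, Finset.mul_sum]
      congr 3
      refine Finset.sum_congr rfl fun k hk => ?_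
      rw [if_neg (by rintro rfl; exact ha hk), mul_assoc]
    by_cases hc : Real.circleAverage (fun z => ‖u a z + ∑ k ∈ s, ε k * u k z‖ ^ 2) 0 1 ≤
        Real.circleAverage (fun z => ‖u a z‖ ^ 2) 0 1 +
        ∑ k ∈ s, Real.circleAverage (fun z => ‖u k z‖ ^ 2) 0 1
    · refine ⟨fun k => if k = a then 1 else 1 * ε k, fun k => ?_, ?_⟩
      · by_cases hk : k = a
        · simp [hk]
        · simpa [hk] using hε k
      · rw [key]; simpa using hc
    · refine ⟨fun k => if k = a then 1 else (-1) * ε k, fun k => ?_, ?_⟩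
      · by_cases hk : k = a
        · simp [hk]
        · rcases hε k with h | h <;> simp [hk, h]
      · rw [key]
        simp only [neg_mul, one_mul, ← sub_eq_add_neg]
        linarith

lemma sgn_ge (S : Finset ℕ) {u : ℕ → ℂ → ℂ} (hu : ∀ k z, ‖z‖ = 1 → ContinuousAt (u k) z) :
    ∃ ε : ℕ → ℂ, (∀ k, ε k = 1 ∨ ε k = -1) ∧
      ∑ k ∈ S, Real.circleAverage (fun z => ‖u k z‖ ^ 2) 0 1 ≤
      Real.circleAverage (fun z => ‖∑ k ∈ S, ε k * u k z‖ ^ 2) 0 1 := by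
  classical
  induction S using Finset.induction_on with
  | empty => exact ⟨fun _ => 1, fun _ => Or.inl rfl, by simp [Real.circleAverage_const]⟩
  | insert a s ha ih =>
    obtain ⟨ε, hε, h⟩ := ih
    have hp := par_avg (u := u a) (v := fun z => ∑ k ∈ s, ε k * u k z) (hu a) (cont_sum hu ε)
    rw [Finset.sum_insert ha]
    have key : ∀ η : ℂ, (fun z => ‖∑ k ∈ insert a s, (if k = a then 1 else η * ε k) * u k z‖ ^ 2) =
        fun z => ‖u a z + η * ∑ k ∈ s, ε k * u k z‖ ^ 2 := by
      intro η
      ext z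
      rw [Finset.sum_insert ha, if_pos rfl, one_mul, Finset.mul_sum]
      congr 3
      refine Finset.sum_congr rfl fun k hk => ?_
      rw [if_neg (by rintro rfl; exact ha hk), mul_assoc]
    by_cases hc : Real.circleAverage (fun z => ‖u a z‖ ^ 2) 0 1 +
        ∑ k ∈ s, Real.circleAverage (fun z => ‖u k z‖ ^ 2) 0 1 ≤
        Real.circleAverage (fun z => ‖u a z + ∑ k ∈ s, ε k * u k z‖ ^ 2) 0 1
    · refine ⟨fun k => if k = a then 1 else 1 * ε k, fun k => ?_, ?_⟩
      · by_cases hk : k = a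
        · simp [hk]
        · simpa [hk] using hε k
      · rw [key]; simpa using hc
    · refine ⟨fun k => if k = a then 1 else (-1) * ε k, fun k => ?_, ?_⟩
      · by_cases hk : k = a
        · simp [hk]
        · rcases hε k with h | h <;> simp [hk, h]
      · rw [key]
        simp only [neg_mul, one_mul, ← sub_eq_add_neg]
        linarith

lemma En_congr {S : Finset ℕ} (lam : ℕ → ℂ) {c d : ℕ → ℂ} (h : ∀ k ∈ S, c k = d k) :
    En S lam c = En S lam d := by
  unfold En
  congr 1
  ext z
  rw [Finset.sum_congr rfl fun k hk => by rw [h k hk]]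

lemma single_avg {lam : ℕ → ℂ} (hl : ∀ k, ‖lam k‖ < 1) (c : ℕ → ℂ) (k : ℕ) :
    Real.circleAverage (fun z => ‖c k * ck (lam k) z‖ ^ 2) 0 1 = ‖c k‖ ^ 2 / (1 - ‖lam k‖ ^ 2) := by
  have h := En_eq (S := {k}) hl c
  have h0 : En {k} lam c = Real.circleAverage (fun z => ‖c k * ck (lam k) z‖ ^ 2) 0 1 := by
    simp [En]
  rw [← h0, ← Complex.ofReal_inj, h]
  have hw : (1 - ‖lam k‖ ^ 2) ≠ 0 := by nlinarith [hl k, norm_nonneg (lam k)]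
  have h1 := ck_self (hl k)
  have hw' : ((1 - ‖lam k‖ ^ 2 : ℝ) : ℂ) ≠ 0 := by exact_mod_cast hw
  rw [Complex.ofReal_div, eq_div_iff hw']
  simp only [Finset.sum_singleton]
  push_cast at h1 ⊢
  rw [← Complex.conj_mul' (c k)]
  linear_combination (starRingEnd ℂ) (c k) * c k * h1

lemma riesz (S : Finset ℕ) {lam : ℕ → ℂ} (hl : ∀ k, ‖lam k‖ < 1) {δ : ℝ} (hδ : 0 < δ)
    (hC : ∀ (n : ℕ) (S : Finset ℕ), n ∉ S → δ ≤ ∏ k ∈ S, ‖bl (lam k) (lam n)‖) (c : ℕ → ℂ) :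
    ∑ k ∈ S, ‖c k‖ ^ 2 / (1 - ‖lam k‖ ^ 2) ≤ (2 * Real.exp 1 / δ ^ 3) ^ 2 * En S lam c ∧
    En S lam c ≤ (2 * Real.exp 1 / δ ^ 3) ^ 2 * ∑ k ∈ S, ‖c k‖ ^ 2 / (1 - ‖lam k‖ ^ 2) := by
  have hu : ∀ k z, ‖z‖ = 1 → ContinuousAt (fun z => c k * ck (lam k) z) z := by
    intro k z hz
    exact continuousAt_const.mul (ck_diff (hl k) hz.le).continuousAt
  have hn : ∀ {ε : ℕ → ℂ}, (∀ k, ε k = 1 ∨ ε k = -1) → ∀ k, ‖ε k‖ ≤ 1 := by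
    intro ε h k
    rcases h k with h | h <;> simp [h]
  simp only [← single_avg hl c]
  constructor
  · obtain ⟨ε, hε, h⟩ := sgn_ge S hu
    obtain ⟨f, hf1, hf2, hf3⟩ := jones_interp S hl hδ hC ε (hn hε)
    have h2 := En_mult (S := S) hl c hf1 (fun z hz => hf3 z hz.le)
    refine le_trans (h.trans (le_of_eq ?_)) h2
    unfold En
    congr 1
    ext z
    rw [Finset.sum_congr rfl fun k hk => ?_]
    simp only [hf2 k hk]
    rcases hε k with h | h <;> simp [h]
  · obtain ⟨ε, hε, h⟩ := sgn_le S hu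
    obtain ⟨f, hf1, hf2, hf3⟩ := jones_interp S hl hδ hC ε (hn hε)
    have h2 := En_mult (S := S) hl (fun k => ε k * c k) hf1 (fun z hz => hf3 z hz.le)
    have e1 : En S lam (fun k => (starRingEnd ℂ) (f (lam k)) * (ε k * c k)) = En S lam c := by
      apply En_congr
      intro k hk
      rw [hf2 k hk]
      rcases hε k with h | h <;> simp [h]
    rw [e1] at h2
    refine h2.trans (mul_le_mul_of_nonneg_left (le_trans (le_of_eq ?_) h) (by positivity))
    unfold En
    simp only [mul_assoc]

lemma pf_base {a b : ℂ} (ha : ‖a‖ < 1) (hb : ‖b‖ < 1) (hab : a ≠ b) :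
    ∃ α β : ℂ, (starRingEnd ℂ) (bl a b) * β = 1 ∧
      ∀ z, ‖z‖ ≤ 1 → bl a z * ck b z = α * ck a z + β * ck b z := by
  have h1 : (starRingEnd ℂ) b - (starRingEnd ℂ) a ≠ 0 := by
    rw [← map_sub, ne_eq, map_eq_zero, sub_eq_zero]; exact hab.symm
  have h2 : 1 - a * (starRingEnd ℂ) b ≠ 0 := by
    have := one_sub_ne hb ha.le
    rwa [mul_comm] at this
  refine ⟨-a - (1 - a * (starRingEnd ℂ) b) / ((starRingEnd ℂ) b - (starRingEnd ℂ) a),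
    (1 - a * (starRingEnd ℂ) b) / ((starRingEnd ℂ) b - (starRingEnd ℂ) a), ?_, ?_⟩
  · simp only [bl, map_div₀, map_sub, map_one, map_mul, Complex.conj_conj]
    rw [div_mul_div_cancel₀ h2, div_self h1]
  · intro z hz
    have h3 := one_sub_ne ha hz
    have h4 := one_sub_ne hb hz
    simp only [bl, ck]
    generalize (starRingEnd ℂ) a = a' at *
    generalize (starRingEnd ℂ) b = b' at *
    rw [← div_eq_mul_inv, ← div_eq_mul_inv, ← div_eq_mul_inv, div_div, div_add_div _ _ h3 h4,
      div_left_inj' (mul_ne_zero h3 h4)]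
    have h5 : (1 - a * b') / (b' - a') * (b' - a') = 1 - a * b' := div_mul_cancel₀ _ h1
    generalize (1 - a * b') / (b' - a') = β at *
    linear_combination (-z) * h5

lemma pf (S : Finset ℕ) {lam : ℕ → ℂ} (hl : ∀ k, ‖lam k‖ < 1) (hinj : Function.Injective lam)
    {n : ℕ} (hn : n ∉ S) :
    ∃ a : ℕ → ℂ, ∀ z, ‖z‖ ≤ 1 → (∏ m ∈ S, ((starRingEnd ℂ) (bl (lam m) (lam n)) * bl (lam m) z)) *
      ck (lam n) z = ck (lam n) z + ∑ j ∈ S, a j * ck (lam j) z := by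
  classical
  induction S using Finset.induction_on with
  | empty => exact ⟨fun _ => 0, fun z _ => by simp⟩
  | insert m s hm ih =>
    obtain ⟨a, ha⟩ := ih (fun h => hn (Finset.mem_insert_of_mem h))
    have hmn : m ≠ n := fun h => hn (by rw [h]; exact Finset.mem_insert_self _ _)
    have hb : ∀ j, ∃ αβ : ℂ × ℂ, j ≠ m → ((starRingEnd ℂ) (bl (lam m) (lam j)) * αβ.2 = 1 ∧
        ∀ z, ‖z‖ ≤ 1 → bl (lam m) z * ck (lam j) z = αβ.1 * ck (lam m) z + αβ.2 * ck (lam j) z) := by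
      intro j
      by_cases hj : j = m
      · exact ⟨0, fun h => absurd hj h⟩
      · obtain ⟨α, β, h⟩ := pf_base (hl m) (hl j) (fun h => hj (hinj h).symm)
        exact ⟨(α, β), fun _ => h⟩
    choose p hp using hb
    set κ := (starRingEnd ℂ) (bl (lam m) (lam n)) with hκ
    refine ⟨fun j => if j = m then κ * ((p n).1 + ∑ i ∈ s, a i * (p i).1) else κ * (a j * (p j).2), ?_⟩
    intro z hz
    rw [Finset.prod_insert hm, mul_assoc, ha z hz, Finset.sum_insert hm]
    simp only [if_true]
    have e1 : ∑ j ∈ s, (if j = m then κ * ((p n).1 + ∑ i ∈ s, a i * (p i).1) else κ * (a j * (p j).2)) *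
        ck (lam j) z = κ * ∑ j ∈ s, a j * ((p j).2 * ck (lam j) z) := by
      rw [Finset.mul_sum]
      refine Finset.sum_congr rfl fun j hj => ?_
      rw [if_neg (by rintro rfl; exact hm hj)]
      ring
    have e2 : bl (lam m) z * ∑ j ∈ s, a j * ck (lam j) z =
        (∑ i ∈ s, a i * (p i).1) * ck (lam m) z + ∑ j ∈ s, a j * ((p j).2 * ck (lam j) z) := by
      rw [Finset.mul_sum, Finset.sum_mul, ← Finset.sum_add_distrib]
      refine Finset.sum_congr rfl fun j hj => ?_
      have := (hp j (by rintro rfl; exact hm hj)).2 z hz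
      linear_combination a j * this
    rw [e1]
    obtain ⟨q1, q2⟩ := hp n hmn.symm
    linear_combination κ * e2 + κ * q2 z hz + ck (lam n) z * q1

lemma pf_En (S : Finset ℕ) {lam : ℕ → ℂ} (hl : ∀ k, ‖lam k‖ < 1) (hinj : Function.Injective lam)
    {n : ℕ} (hn : n ∉ S) :
    ∃ a : ℕ → ℂ, a n = 1 ∧ En (insert n S) lam a =
      (∏ m ∈ S, ‖bl (lam m) (lam n)‖) ^ 2 / (1 - ‖lam n‖ ^ 2) := by
  classical
  obtain ⟨a, ha⟩ := pf S hl hinj hn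
  refine ⟨fun k => if k = n then 1 else a k, if_pos rfl, ?_⟩
  have h := single_avg hl (fun _ => ∏ m ∈ S, ((‖bl (lam m) (lam n)‖ : ℝ) : ℂ)) n
  rw [norm_prod] at h
  simp only [Complex.norm_real, norm_norm] at h
  rw [← h]
  unfold En
  apply Real.circleAverage_congr_sphere
  intro z hz
  have hz1 : ‖z‖ = 1 := by simpa using hz
  have e : ∑ k ∈ insert n S, (if k = n then 1 else a k) * ck (lam k) z =
      ck (lam n) z + ∑ j ∈ S, a j * ck (lam j) z := by
    rw [Finset.sum_insert hn, if_pos rfl, one_mul]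
    congr 1
    refine Finset.sum_congr rfl fun j hj => ?_
    rw [if_neg (by rintro rfl; exact hn hj)]
  simp only
  rw [e, ← ha z hz1.le, norm_mul, norm_mul, norm_prod, norm_prod]
  have e3 : ∀ m ∈ S, ‖(starRingEnd ℂ) (bl (lam m) (lam n)) * bl (lam m) z‖ =
      ‖((‖bl (lam m) (lam n)‖ : ℝ) : ℂ)‖ := by
    intro m _
    rw [norm_mul, RCLike.norm_conj, bl_eq_one (hl m) hz1]
    simp
  rw [Finset.prod_congr rfl e3]

section
open ContinuousLinearMap

variable {H : Type*} [NormedAddCommGroup H] [InnerProductSpace ℂ H] [CompleteSpace H]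

lemma adj_eig {A : H →L[ℂ] H} (hA : IsStarNormal A) {μ : ℂ} {v : H} (h : A v = μ • v) :
    (adjoint A) v = (starRingEnd ℂ) μ • v := by
  have hN : IsStarNormal (A - μ • (1 : H →L[ℂ] H)) := by
    constructor
    have := hA.star_comm_self
    simp only [star_sub, star_smul, star_one]
    have h1 : star A * A = A * star A := this
    show (star A - star μ • 1) * (A - μ • 1) = (A - μ • 1) * (star A - star μ • 1)
    simp only [sub_mul, mul_sub, smul_mul_assoc, mul_smul_comm, one_mul, mul_one, h1, smul_sub]
    rw [smul_comm μ (star μ)]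
    abel
  have h2 := (ContinuousLinearMap.IsStarNormal.adjoint_apply_eq_zero_iff hN v).mpr (by simp [h])
  rw [← star_eq_adjoint, star_sub, star_smul, star_one, star_eq_adjoint] at h2
  simp only [sub_apply, smul_apply, one_apply_eq_self] at h2
  exact sub_eq_zero.mp h2

lemma inner_pow_eig {A : H →L[ℂ] H} (hA : IsStarNormal A) {μ : ℂ} {v : H} (h : A v = μ • v) (g : H)
    (n : ℕ) : ⟪v, (A ^ n) g⟫_ℂ = μ ^ n * ⟪v, g⟫_ℂ := by
  induction n with
  | zero => simp
  | succ n ih =>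
    rw [pow_succ', mul_apply_eq_comp, ← adjoint_inner_left, adj_eig hA h, inner_smul_left, ih]
    simp [pow_succ']; ring

lemma inner_sum_hasSum {A : H →L[ℂ] H} (hA : IsStarNormal A) {b : ℕ → H} {lam : ℕ → ℂ}
    (hb : ∀ k, A (b k) = lam k • b k) (hl : ∀ k, ‖lam k‖ < 1) (g : H) (S : Finset ℕ) (a : ℕ → ℂ) :
    HasSum (fun n : ℕ => ‖⟪∑ k ∈ S, a k • b k, (A ^ n) g⟫_ℂ‖ ^ 2)
      (En S lam (fun k => a k * (starRingEnd ℂ) ⟪b k, g⟫_ℂ)) := by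
  convert En_hasSum (S := S) hl (fun k => a k * (starRingEnd ℂ) ⟪b k, g⟫_ℂ) using 3 with n
  rw [← RCLike.norm_conj, sum_inner, map_sum]
  congr 1
  refine Finset.sum_congr rfl fun k _ => ?_
  rw [inner_smul_left, inner_pow_eig hA (hb k)]
  simp only [map_mul, map_pow, Complex.conj_conj]
  ring

lemma orth_norm_sq {b : ℕ → H} (hb : Orthonormal ℂ b) (S : Finset ℕ) (a : ℕ → ℂ) :
    ‖∑ k ∈ S, a k • b k‖ ^ 2 = ∑ k ∈ S, ‖a k‖ ^ 2 := by
  have h := hb.inner_sum a a S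
  rw [inner_self_eq_norm_sq_to_K] at h
  have h2 : ((‖∑ k ∈ S, a k • b k‖ ^ 2 : ℝ) : ℂ) = ((∑ k ∈ S, ‖a k‖ ^ 2 : ℝ) : ℂ) := by
    push_cast
    rw [show ((‖∑ k ∈ S, a k • b k‖ : ℝ) : ℂ) ^ 2 = _ from h]
    refine Finset.sum_congr rfl fun k _ => ?_
    rw [Complex.conj_mul']
  exact_mod_cast h2

lemma backward {A : H →L[ℂ] H} (hA : IsStarNormal A) (g : H) (b : HilbertBasis ℕ ℂ H) (lam : ℕ → ℂ)
    (hb : ∀ k : ℕ, A (b k) = lam k • b k) (hl : ∀ k : ℕ, ‖lam k‖ < 1) {δ : ℝ} (hδ : 0 < δ)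
    (hC : ∀ (n : ℕ) (S : Finset ℕ), n ∉ S → δ ≤ ∏ k ∈ S, ‖bl (lam k) (lam n)‖)
    {c' C' : ℝ} (hc' : 0 < c')
    (hcc : ∀ k : ℕ, c' ≤ ‖⟪(b k : H), g⟫_ℂ‖ / Real.sqrt (1 - ‖lam k‖ ^ 2) ∧
        ‖⟪(b k : H), g⟫_ℂ‖ / Real.sqrt (1 - ‖lam k‖ ^ 2) ≤ C') :
    ∃ c C : ℝ, 0 < c ∧ c ≤ C ∧ ∀ f : H,
        c * ‖f‖ ^ 2 ≤ ∑' n : ℕ, ‖⟪f, (A ^ n) g⟫_ℂ‖ ^ 2 ∧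
        ∑' n : ℕ, ‖⟪f, (A ^ n) g⟫_ℂ‖ ^ 2 ≤ C * ‖f‖ ^ 2 := by
  set M := 2 * Real.exp 1 / δ ^ 3 with hMdef
  have hM : 0 < M := by positivity
  have hw : ∀ k, 0 < 1 - ‖lam k‖ ^ 2 := fun k => by nlinarith [hl k, norm_nonneg (lam k)]
  have hcc2 : ∀ k, c' ^ 2 ≤ ‖⟪(b k : H), g⟫_ℂ‖ ^ 2 / (1 - ‖lam k‖ ^ 2) ∧
      ‖⟪(b k : H), g⟫_ℂ‖ ^ 2 / (1 - ‖lam k‖ ^ 2) ≤ C' ^ 2 := by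
    intro k
    obtain ⟨h1, h2⟩ := hcc k
    have e : ‖⟪(b k : H), g⟫_ℂ‖ ^ 2 / (1 - ‖lam k‖ ^ 2) =
        (‖⟪(b k : H), g⟫_ℂ‖ / Real.sqrt (1 - ‖lam k‖ ^ 2)) ^ 2 := by
      rw [div_pow, Real.sq_sqrt (hw k).le]
    rw [e]
    constructor <;> gcongr
  -- finite sums
  have fin : ∀ (S : Finset ℕ) (a : ℕ → ℂ),
      Summable (fun n : ℕ => ‖⟪∑ k ∈ S, a k • b k, (A ^ n) g⟫_ℂ‖ ^ 2) ∧
      c' ^ 2 / M ^ 2 * ‖∑ k ∈ S, a k • b k‖ ^ 2 ≤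
        ∑' n : ℕ, ‖⟪∑ k ∈ S, a k • b k, (A ^ n) g⟫_ℂ‖ ^ 2 ∧
      ∑' n : ℕ, ‖⟪∑ k ∈ S, a k • b k, (A ^ n) g⟫_ℂ‖ ^ 2 ≤
        M ^ 2 * C' ^ 2 * ‖∑ k ∈ S, a k • b k‖ ^ 2 := by
    intro S a
    have hs := inner_sum_hasSum hA (b := b) hb hl g S a
    obtain ⟨r1, r2⟩ := riesz S hl hδ hC (fun k => a k * (starRingEnd ℂ) ⟪b k, g⟫_ℂ)
    rw [hs.tsum_eq, orth_norm_sq b.orthonormal]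
    have e : ∀ k, ‖a k * (starRingEnd ℂ) ⟪b k, g⟫_ℂ‖ ^ 2 / (1 - ‖lam k‖ ^ 2) =
        ‖a k‖ ^ 2 * (‖⟪(b k : H), g⟫_ℂ‖ ^ 2 / (1 - ‖lam k‖ ^ 2)) := by
      intro k
      rw [norm_mul, RCLike.norm_conj, mul_pow, mul_div_assoc]
    simp only [e] at r1 r2
    refine ⟨hs.summable, ?_, ?_⟩
    · have : c' ^ 2 * ∑ k ∈ S, ‖a k‖ ^ 2 ≤
          ∑ k ∈ S, ‖a k‖ ^ 2 * (‖⟪(b k : H), g⟫_ℂ‖ ^ 2 / (1 - ‖lam k‖ ^ 2)) := by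
        rw [Finset.mul_sum]
        refine Finset.sum_le_sum fun k _ => ?_
        rw [mul_comm]
        exact mul_le_mul_of_nonneg_left (hcc2 k).1 (by positivity)
      rw [div_mul_eq_mul_div, div_le_iff₀ (by positivity), mul_comm (En _ _ _)]
      exact this.trans r1
    · refine r2.trans ?_
      rw [mul_assoc]
      refine mul_le_mul_of_nonneg_left ?_ (by positivity)
      rw [Finset.mul_sum]
      refine Finset.sum_le_sum fun k _ => ?_
      rw [mul_comm]
      exact mul_le_mul_of_nonneg_right (hcc2 k).2 (by positivity)
  set K := M ^ 2 * C' ^ 2 with hK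
  have app : ∀ f : H, Filter.Tendsto (fun S : Finset ℕ => ∑ k ∈ S, b.repr f k • b k)
      Filter.atTop (nhds f) := fun f => b.hasSum_repr f
  have part : ∀ (f : H) (s : Finset ℕ), ∑ n ∈ s, ‖⟪f, (A ^ n) g⟫_ℂ‖ ^ 2 ≤ K * ‖f‖ ^ 2 := by
    intro f s
    have t1 : Filter.Tendsto (fun S : Finset ℕ =>
        ∑ n ∈ s, ‖⟪∑ k ∈ S, b.repr f k • b k, (A ^ n) g⟫_ℂ‖ ^ 2) Filter.atTop
        (nhds (∑ n ∈ s, ‖⟪f, (A ^ n) g⟫_ℂ‖ ^ 2)) := by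
      apply tendsto_finsetSum
      intro n _
      exact ((app f).inner tendsto_const_nhds).norm.pow 2
    have t2 := ((app f).norm.pow 2).const_mul K
    refine le_of_tendsto_of_tendsto' t1 t2 fun S => ?_
    obtain ⟨f1, _, f3⟩ := fin S (fun k => b.repr f k)
    exact (f1.sum_le_tsum s (fun _ _ => by positivity)).trans f3
  have summ : ∀ f : H, Summable (fun n : ℕ => ‖⟪f, (A ^ n) g⟫_ℂ‖ ^ 2) := fun f =>
    summable_of_sum_le (fun _ => by positivity) (part f)
  have upper : ∀ f : H, ∑' n : ℕ, ‖⟪f, (A ^ n) g⟫_ℂ‖ ^ 2 ≤ K * ‖f‖ ^ 2 := fun f =>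
    (summ f).tsum_le_of_sum_le (part f)
  refine ⟨c' ^ 2 / M ^ 2 / 2, K + c' ^ 2 / M ^ 2 / 2, by positivity,
    by have : 0 ≤ K := by positivity
       linarith, fun f => ⟨?_, ?_⟩⟩
  · have t1 := ((app f).norm.pow 2).const_mul (c' ^ 2 / M ^ 2)
    have t2 : Filter.Tendsto (fun S : Finset ℕ => 2 * ∑' n : ℕ, ‖⟪f, (A ^ n) g⟫_ℂ‖ ^ 2 +
        2 * (K * ‖(∑ k ∈ S, b.repr f k • b k) - f‖ ^ 2)) Filter.atTop
        (nhds (2 * ∑' n : ℕ, ‖⟪f, (A ^ n) g⟫_ℂ‖ ^ 2 + 2 * (K * ‖f - f‖ ^ 2))) :=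
      ((((((app f).sub tendsto_const_nhds).norm.pow 2).const_mul K).const_mul 2).const_add _)
    have := le_of_tendsto_of_tendsto' t1 t2 fun S => ?_
    · simp only [sub_self, norm_zero] at this
      linarith
    · refine (fin S (fun k => b.repr f k)).2.1.trans ?_
      set u := ∑ k ∈ S, b.repr f k • b k with hu
      have h1 : ∑' n : ℕ, ‖⟪u, (A ^ n) g⟫_ℂ‖ ^ 2 ≤ ∑' n : ℕ, (2 * ‖⟪f, (A ^ n) g⟫_ℂ‖ ^ 2 +
          2 * ‖⟪u - f, (A ^ n) g⟫_ℂ‖ ^ 2) := by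
        apply Summable.tsum_le_tsum _ (summ u) (((summ f).mul_left 2).add ((summ (u - f)).mul_left 2))
        intro n
        have e : ⟪u, (A ^ n) g⟫_ℂ = ⟪f, (A ^ n) g⟫_ℂ + ⟪u - f, (A ^ n) g⟫_ℂ := by
          rw [← inner_add_left]; simp
        rw [e]
        have := norm_add_le ⟪f, (A ^ n) g⟫_ℂ ⟪u - f, (A ^ n) g⟫_ℂ
        have h3 : ‖⟪f, (A ^ n) g⟫_ℂ + ⟪u - f, (A ^ n) g⟫_ℂ‖ ^ 2 ≤
          (‖⟪f, (A ^ n) g⟫_ℂ‖ + ‖⟪u - f, (A ^ n) g⟫_ℂ‖) ^ 2 := by gcongr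
        nlinarith [sq_nonneg (‖⟪f, (A ^ n) g⟫_ℂ‖ - ‖⟪u - f, (A ^ n) g⟫_ℂ‖)]
      rw [((summ f).mul_left 2).tsum_add ((summ (u - f)).mul_left 2), tsum_mul_left, tsum_mul_left] at h1
      have h2 := upper (u - f)
      linarith
  · have h1 := upper f
    have h2 : 0 ≤ c' ^ 2 / M ^ 2 / 2 * ‖f‖ ^ 2 := by positivity
    nlinarith

end

section
open ContinuousLinearMap

variable {H : Type*} [NormedAddCommGroup H] [InnerProductSpace ℂ H] [CompleteSpace H]

lemma fr_summ {A : H →L[ℂ] H} {g : H} {c : ℝ} (hc : 0 < c)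
    (hlow : ∀ f : H, c * ‖f‖ ^ 2 ≤ ∑' n : ℕ, ‖⟪f, (A ^ n) g⟫_ℂ‖ ^ 2) (f : H) :
    Summable (fun n : ℕ => ‖⟪f, (A ^ n) g⟫_ℂ‖ ^ 2) := by
  by_contra h
  have h1 := hlow f
  rw [tsum_eq_zero_of_not_summable h] at h1
  have h2 : ‖f‖ ^ 2 = 0 := by
    have : 0 ≤ ‖f‖ ^ 2 := by positivity
    nlinarith
  have h3 : f = 0 := by simpa using h2
  apply h
  simp [h3, summable_zero]

lemma norm_adj {A : H →L[ℂ] H} (hA : IsStarNormal A) (f : H) : ‖(adjoint A) f‖ = ‖A f‖ :=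
  ((ContinuousLinearMap.isStarNormal_iff_norm_eq_adjoint).mp hA f).symm

lemma fr_tend {A : H →L[ℂ] H} (hA : IsStarNormal A) {g : H} {c : ℝ} (hc : 0 < c)
    (hlow : ∀ f : H, c * ‖f‖ ^ 2 ≤ ∑' n : ℕ, ‖⟪f, (A ^ n) g⟫_ℂ‖ ^ 2) (f : H) :
    Filter.Tendsto (fun n : ℕ => ‖(A ^ n) f‖) Filter.atTop (nhds 0) := by
  have h1 := tendsto_sum_nat_add (fun n : ℕ => ‖⟪f, (A ^ n) g⟫_ℂ‖ ^ 2)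
  have h2 : ∀ n : ℕ, ‖(A ^ n) f‖ ^ 2 ≤ (∑' m : ℕ, ‖⟪f, (A ^ (m + n)) g⟫_ℂ‖ ^ 2) / c := by
    intro n
    have hn : IsStarNormal (A ^ n) :=
      ⟨by rw [star_pow]; exact hA.star_comm_self.pow_pow n n⟩
    rw [← norm_adj hn, le_div_iff₀ hc, mul_comm]
    refine (hlow _).trans (le_of_eq ?_)
    refine tsum_congr fun m => ?_
    rw [adjoint_inner_left, add_comm m n, pow_add, mul_apply_eq_comp]
  have h3 : Filter.Tendsto (fun n : ℕ => ‖(A ^ n) f‖ ^ 2) Filter.atTop (nhds 0) :=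
    squeeze_zero (fun _ => by positivity) h2 (by simpa using h1.div_const c)
  have h4 := h3.sqrt
  simpa using h4

lemma norm_sq_le {A : H →L[ℂ] H} (hA : IsStarNormal A) (f : H) :
    ‖A f‖ ^ 2 ≤ ‖f‖ * ‖A (A f)‖ := by
  rw [← norm_adj hA (A f), ← inner_self_eq_norm_sq (𝕜 := ℂ), ← adjoint_inner_left, mul_comm]
  exact (RCLike.re_le_norm _).trans (norm_inner_le_norm _ _)

lemma fr_contr {A : H →L[ℂ] H} (hA : IsStarNormal A) {f : H}
    (ht : Filter.Tendsto (fun n : ℕ => ‖(A ^ n) f‖) Filter.atTop (nhds 0)) : ‖A f‖ ≤ ‖f‖ := by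
  by_contra hlt
  push Not at hlt
  have key : ∀ n : ℕ, ‖f‖ ≤ ‖(A ^ n) f‖ ∧ ‖(A ^ n) f‖ < ‖(A ^ (n + 1)) f‖ := by
    intro n
    induction n with
    | zero => simpa using hlt
    | succ n ih =>
      refine ⟨ih.1.trans ih.2.le, ?_⟩
      have h := norm_sq_le hA ((A ^ n) f)
      have e1 : A ((A ^ n) f) = (A ^ (n + 1)) f := by rw [pow_succ', mul_apply_eq_comp]
      have e2 : A ((A ^ (n + 1)) f) = (A ^ (n + 1 + 1)) f := by rw [pow_succ' _ (n + 1), mul_apply_eq_comp]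
      rw [e1, e2] at h
      by_contra h3
      push Not at h3
      nlinarith [norm_nonneg ((A ^ n) f), norm_nonneg f, ih.2]
  have h1 : ∀ n : ℕ, ‖A f‖ ≤ ‖(A ^ (n + 1)) f‖ := by
    intro n
    induction n with
    | zero => simp
    | succ n ih => exact ih.trans (key (n + 1)).2.le
  have h2 := ge_of_tendsto' (ht.comp (Filter.tendsto_add_atTop_nat 1)) h1
  have := norm_nonneg f
  linarith

/-- The defect operator. -/
noncomputable def dfct (A : H →L[ℂ] H) : H →L[ℂ] H := 1 - adjoint A * A

lemma dfct_apply (A : H →L[ℂ] H) (f : H) : dfct A f = f - adjoint A (A f) := rfl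

lemma dfct_symm (A : H →L[ℂ] H) (x y : H) : ⟪dfct A x, y⟫_ℂ = ⟪x, dfct A y⟫_ℂ := by
  rw [dfct_apply, dfct_apply, inner_sub_left, inner_sub_right, adjoint_inner_left, adjoint_inner_right]

lemma dfct_norm {A : H →L[ℂ] H} (hA : IsStarNormal A) (hct : ∀ f, ‖A f‖ ≤ ‖f‖) (f : H) :
    ‖dfct A f‖ ^ 2 ≤ ‖f‖ ^ 2 - ‖A f‖ ^ 2 := by
  rw [dfct_apply, norm_sub_sq (𝕜 := ℂ), adjoint_inner_right, inner_self_eq_norm_sq, norm_adj hA]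
  have := hct (A f)
  nlinarith [norm_nonneg (A (A f))]

lemma compact_dfct {A : H →L[ℂ] H} (hA : IsStarNormal A) {g : H} {c : ℝ} (hc : 0 < c)
    (hlow : ∀ f : H, c * ‖f‖ ^ 2 ≤ ∑' n : ℕ, ‖⟪f, (A ^ n) g⟫_ℂ‖ ^ 2) :
    IsCompactOperator (dfct A) := by
  classical
  have hct : ∀ f, ‖A f‖ ≤ ‖f‖ := fun f => fr_contr hA (fr_tend hA hc hlow f)
  set v : ℕ → H := fun n => dfct A ((A ^ n) g) with hv
  have hvs : Summable (fun n => ‖v n‖ ^ 2) := by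
    refine summable_of_sum_range_le (c := ‖g‖ ^ 2) (fun _ => by positivity) fun N => ?_
    have : ∑ n ∈ Finset.range N, ‖v n‖ ^ 2 ≤ ‖g‖ ^ 2 - ‖(A ^ N) g‖ ^ 2 := by
      induction N with
      | zero => simp
      | succ N ih =>
        rw [Finset.sum_range_succ]
        have h := dfct_norm hA hct ((A ^ N) g)
        have e1 : A ((A ^ N) g) = (A ^ (N + 1)) g := by rw [pow_succ', mul_apply_eq_comp]
        rw [e1] at h
        simp only [hv] at ih ⊢
        linarith
    nlinarith [norm_nonneg ((A ^ N) g)]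
  have hlow2 : ∀ f, c * ‖dfct A f‖ ^ 2 ≤ ∑' n, ‖⟪f, v n⟫_ℂ‖ ^ 2 := by
    intro f
    refine (hlow _).trans (le_of_eq (tsum_congr fun n => ?_))
    rw [dfct_symm]
  have hsf : ∀ f, Summable (fun n => ‖⟪f, v n⟫_ℂ‖ ^ 2) := by
    intro f
    convert fr_summ hc hlow (dfct A f) using 4 with n
    rw [dfct_symm]
  set U : ℕ → Submodule ℂ H := fun N => Submodule.span ℂ ((Finset.range N).image v : Set H) with hU
  have : ∀ N, FiniteDimensional ℂ (U N) := fun N => FiniteDimensional.span_finset ℂ _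
  set T : ℕ → ℝ := fun N => ∑' n, ‖v (n + N)‖ ^ 2 with hT
  have hT0 : Filter.Tendsto T Filter.atTop (nhds 0) := tendsto_sum_nat_add (fun n => ‖v n‖ ^ 2)
  have hTn : ∀ N, 0 ≤ T N := fun N => tsum_nonneg fun _ => by positivity
  have bd : ∀ N f, f ∈ (U N)ᗮ → ‖dfct A f‖ ^ 2 ≤ T N / c * ‖f‖ ^ 2 := by
    intro N f hf
    rw [div_mul_eq_mul_div, le_div_iff₀ hc, mul_comm _ c]
    refine (hlow2 f).trans ?_
    rw [← (hsf f).sum_add_tsum_nat_add N, Finset.sum_eq_zero, zero_add, hT, ← tsum_mul_right]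
    · refine Summable.tsum_le_tsum (fun n => ?_) ((summable_nat_add_iff N).mpr (hsf f))
        (((summable_nat_add_iff N).mpr hvs).mul_right _)
      rw [← mul_pow, mul_comm]
      have := norm_inner_le_norm (𝕜 := ℂ) f (v (n + N))
      gcongr
    · intro n hn
      have : ⟪f, v n⟫_ℂ = 0 := by
        refine Submodule.inner_left_of_mem_orthogonal (K := U N) (Submodule.subset_span ?_) hf
        exact Finset.mem_coe.mpr (Finset.mem_image_of_mem v hn)
      simp [this]
  have hlim : Filter.Tendsto (fun N => dfct A ∘L (U N).starProjection) Filter.atTop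
      (nhds (dfct A)) := by
    rw [tendsto_iff_norm_sub_tendsto_zero]
    have : Filter.Tendsto (fun N => Real.sqrt (T N / c)) Filter.atTop (nhds 0) := by
      simpa using (hT0.div_const c).sqrt
    refine squeeze_zero (fun _ => norm_nonneg _) (fun N => ?_) this
    refine ContinuousLinearMap.opNorm_le_bound _ (Real.sqrt_nonneg _) fun f => ?_
    have e : (dfct A ∘L (U N).starProjection - dfct A) f = - dfct A (f - (U N).starProjection f) := by
      simp
    rw [e, norm_neg]
    have h1 := bd N _ (Submodule.sub_starProjection_mem_orthogonal (K := U N) f)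
    have h2 : ‖f - (U N).starProjection f‖ ≤ ‖f‖ := by
      have := (U N)ᗮ.norm_starProjection_apply_le f
      rwa [Submodule.starProjection_orthogonal_val] at this
    refine (sq_le_sq₀ (norm_nonneg _) (by positivity)).mp ?_
    rw [mul_pow, Real.sq_sqrt (div_nonneg (hTn N) hc.le)]
    refine h1.trans ?_
    have := div_nonneg (hTn N) hc.le
    gcongr
  refine isCompactOperator_of_tendsto hlim (Filter.Eventually.of_forall fun N => ?_)
  have hid : IsCompactOperator (ContinuousLinearMap.id ℂ (U N)) :=
    (isCompactOperator_id_iff_finiteDimensional (𝕜 := ℂ)).mpr inferInstance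
  have h1 := (hid.comp_clm ((U N).orthogonalProjectionOnto)).clm_comp (dfct A ∘L (U N).subtypeL)
  exact h1

end

section
open ContinuousLinearMap

variable {H : Type*} [NormedAddCommGroup H] [InnerProductSpace ℂ H] [CompleteSpace H]

lemma dfct_comm {A : H →L[ℂ] H} (hA : IsStarNormal A) (x : H) : dfct A (A x) = A (dfct A x) := by
  have h : star A * A = A * star A := hA.star_comm_self
  have h2 : adjoint A (A (A x)) = A (adjoint A (A x)) := by
    have := congrArg (fun B : H →L[ℂ] H => B (A x)) h
    exact this
  rw [dfct_apply, dfct_apply, map_sub, h2]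

lemma eig_total {A : H →L[ℂ] H} (hA : IsStarNormal A) {g : H} {c : ℝ} (hc : 0 < c)
    (hlow : ∀ f : H, c * ‖f‖ ^ 2 ≤ ∑' n : ℕ, ‖⟪f, (A ^ n) g⟫_ℂ‖ ^ 2)
    {x : H} (hx : ∀ (ν : ℂ) (v : H), A v = ν • v → ⟪v, x⟫_ℂ = 0) : x = 0 := by
  have hcomp := compact_dfct hA hc hlow
  set V : Submodule ℂ H := Submodule.span ℂ {v : H | ∃ ν : ℂ, A v = ν • v} with hV
  have memK : ∀ y, y ∈ Vᗮ ↔ ∀ (ν : ℂ) (v : H), A v = ν • v → ⟪v, y⟫_ℂ = 0 := by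
    intro y
    constructor
    · intro h ν v hv
      exact Submodule.inner_right_of_mem_orthogonal (K := V) (Submodule.subset_span (Set.mem_ofPred.mpr ⟨ν, hv⟩)) h
    · intro h
      rw [Submodule.mem_orthogonal]
      intro u hu
      induction hu using Submodule.span_induction with
      | mem u hu => obtain ⟨ν, hν⟩ := hu; exact h ν u hν
      | zero => simp
      | add u w _ _ h1 h2 => rw [inner_add_left, h1, h2, add_zero]
      | smul a u _ h1 => rw [inner_smul_left, h1, mul_zero]
  have KA : ∀ y ∈ Vᗮ, A y ∈ Vᗮ := by
    intro y hy
    rw [memK] at hy ⊢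
    intro ν v hv
    rw [← adjoint_inner_left, adj_eig hA hv, inner_smul_left, hy ν v hv, mul_zero]
  have KA' : ∀ y ∈ Vᗮ, adjoint A y ∈ Vᗮ := by
    intro y hy
    rw [memK] at hy ⊢
    intro ν v hv
    rw [adjoint_inner_right, hv, inner_smul_left, hy ν v hv, mul_zero]
  have KD : ∀ y ∈ Vᗮ, dfct A y ∈ Vᗮ := by
    intro y hy
    rw [dfct_apply]
    exact Vᗮ.sub_mem hy (KA' _ (KA _ hy))
  suffices hK : Vᗮ = ⊥ by
    have : x ∈ Vᗮ := (memK x).mpr hx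
    rw [hK] at this
    simpa using this
  have hsymm : ((dfct A : H →L[ℂ] H) : H →ₗ[ℂ] H).IsSymmetric := fun u w => dfct_symm A u w
  let S : Vᗮ →L[ℂ] Vᗮ := (dfct A).restrict KD
  have hS_compact : IsCompactOperator S := IsCompactOperator.restrict' (f := (dfct A : H →ₗ[ℂ] H)) hcomp KD
  have hS_symm : S.IsSymmetric := hsymm.restrict_invariant KD
  have hspec := ContinuousLinearMap.orthogonalComplement_iSup_eigenspaces_eq_bot hS_compact hS_symm
  have hall : ∀ μ : ℂ, Module.End.eigenspace (S : Module.End ℂ Vᗮ) μ = ⊥ := by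
    intro μ
    by_contra hne
    by_cases hμ : μ = 0
    · obtain ⟨y, hy, hy0⟩ := Submodule.exists_mem_ne_zero_of_ne_bot hne
      rw [Module.End.mem_eigenspace_iff, hμ, zero_smul] at hy
      have hDy : dfct A (y : H) = 0 := congrArg Subtype.val hy
      have hpow : ∀ n : ℕ, ‖(A ^ n) (y : H)‖ = ‖(y : H)‖ ∧ dfct A ((A ^ n) (y : H)) = 0 := by
        intro n
        induction n with
        | zero => simpa using hDy
        | succ n ih =>
          have e1 : A ((A ^ n) (y : H)) = (A ^ (n + 1)) (y : H) := by
            rw [pow_succ', mul_apply_eq_comp]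
          rw [← e1]
          constructor
          · have h0 := ih.2
            rw [dfct_apply, sub_eq_zero] at h0
            have h2 : ‖A ((A ^ n) (y : H))‖ ^ 2 = ‖(A ^ n) (y : H)‖ ^ 2 := by
              rw [← inner_self_eq_norm_sq (𝕜 := ℂ), ← adjoint_inner_left, ← h0,
                inner_self_eq_norm_sq]
            rw [← ih.1]
            exact (sq_eq_sq₀ (norm_nonneg _) (norm_nonneg _)).mp h2
          · rw [dfct_comm hA, ih.2, map_zero]
      have ht := fr_tend hA hc hlow (y : H)
      simp only [fun n => (hpow n).1] at ht
      have := tendsto_nhds_unique ht tendsto_const_nhds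
      exact hy0 (by simpa using this.symm)
    · have hfd := ContinuousLinearMap.finite_dimensional_eigenspace hS_compact μ hμ
      set W := Module.End.eigenspace (S : Module.End ℂ Vᗮ) μ with hW
      let B : Module.End ℂ Vᗮ := (A : H →ₗ[ℂ] H).restrict KA
      have hB : ∀ w ∈ W, B w ∈ W := by
        intro w hw
        rw [hW, Module.End.mem_eigenspace_iff] at hw ⊢
        have hw' : dfct A (w : H) = μ • (w : H) := congrArg Subtype.val hw
        apply Subtype.ext
        show dfct A (A (w : H)) = μ • A (w : H)
        rw [dfct_comm hA, hw', map_smul]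
      have : Nontrivial W := Submodule.nontrivial_iff_ne_bot.mpr hne
      obtain ⟨ν, hν⟩ := Module.End.exists_eigenvalue (B.restrict hB)
      obtain ⟨w, hw⟩ := hν.exists_hasEigenvector
      have hw1 := hw.apply_eq_smul
      have hw2 : A (((w : W) : Vᗮ) : H) = ν • (((w : W) : Vᗮ) : H) :=
        congrArg (fun t : W => ((t : Vᗮ) : H)) hw1
      have h3 := (memK _).mp ((w : W) : Vᗮ).2 ν _ hw2
      rw [inner_self_eq_zero] at h3
      apply hw.2
      apply Subtype.ext
      apply Subtype.ext
      exact h3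
  simp only [hall, iSup_bot, Submodule.bot_orthogonal_eq_top] at hspec
  rw [← Submodule.subsingleton_iff_eq_bot]
  exact (Submodule.subsingleton_iff ℂ).mp (subsingleton_of_bot_eq_top hspec.symm)

end

section
open ContinuousLinearMap

variable {H : Type*} [NormedAddCommGroup H] [InnerProductSpace ℂ H] [CompleteSpace H]

lemma eig_g {A : H →L[ℂ] H} (hA : IsStarNormal A) {g : H} {c : ℝ} (hc : 0 < c)
    (hlow : ∀ f : H, c * ‖f‖ ^ 2 ≤ ∑' n : ℕ, ‖⟪f, (A ^ n) g⟫_ℂ‖ ^ 2) {ν : ℂ} {v : H}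
    (hv : A v = ν • v) (h0 : ⟪v, g⟫_ℂ = 0) : v = 0 := by
  have h := hlow v
  simp only [inner_pow_eig hA hv, h0, mul_zero, norm_zero] at h
  simp only [ne_eq, OfNat.ofNat_ne_zero, not_false_eq_true, zero_pow, tsum_zero] at h
  have h2 : ‖v‖ ^ 2 = 0 := by
    have : 0 ≤ ‖v‖ ^ 2 := by positivity
    nlinarith
  simpa using h2

lemma fr_basis (hinf : ¬ FiniteDimensional ℂ H) {A : H →L[ℂ] H} (hA : IsStarNormal A) {g : H} {c : ℝ}
    (hc : 0 < c)
    (hlow : ∀ f : H, c * ‖f‖ ^ 2 ≤ ∑' n : ℕ, ‖⟪f, (A ^ n) g⟫_ℂ‖ ^ 2) :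
    ∃ (b : HilbertBasis ℕ ℂ H) (lam : ℕ → ℂ), Function.Injective lam ∧
      ∀ k : ℕ, A (b k) = lam k • b k := by
  let Λ := {ν : ℂ // ∃ v : H, ‖v‖ = 1 ∧ A v = ν • v}
  choose v hv1 hv2 using fun ν : Λ => ν.2
  have horth : Orthonormal ℂ v := by
    refine ⟨hv1, fun i j hij => ?_⟩
    have h1 : ⟪v i, A (v j)⟫_ℂ = j.1 * ⟪v i, v j⟫_ℂ := by rw [hv2 j, inner_smul_right]
    have h2 : ⟪v i, A (v j)⟫_ℂ = i.1 * ⟪v i, v j⟫_ℂ := by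
      rw [← adjoint_inner_left, adj_eig hA (hv2 i), inner_smul_left, Complex.conj_conj]
    have h3 : (i.1 - j.1) * ⟪v i, v j⟫_ℂ = 0 := by rw [sub_mul, ← h1, ← h2, sub_self]
    rcases mul_eq_zero.mp h3 with h | h
    · exact absurd (Subtype.ext (sub_eq_zero.mp h)) hij
    · exact h
  have hg : ∀ ν, ⟪v ν, g⟫_ℂ ≠ 0 := by
    intro ν h
    have := eig_g hA hc hlow (hv2 ν) h
    have h1 := hv1 ν
    rw [this] at h1
    simp at h1
  have htot : (Submodule.span ℂ (Set.range v))ᗮ = ⊥ := by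
    rw [Submodule.eq_bot_iff]
    intro x hx
    refine eig_total hA hc hlow fun ν w hw => ?_
    by_cases hw0 : w = 0
    · simp [hw0]
    let i : Λ := ⟨ν, ((‖w‖⁻¹ : ℝ) : ℂ) • w, by
      rw [norm_smul]; simp [hw0], by rw [map_smul, hw, smul_comm]⟩
    have hvx : ⟪v i, x⟫_ℂ = 0 :=
      Submodule.inner_right_of_mem_orthogonal (Submodule.subset_span (Set.mem_range_self i)) hx
    have hu : (starRingEnd ℂ) ⟪v i, g⟫_ℂ • w - (starRingEnd ℂ) ⟪w, g⟫_ℂ • v i = 0 := by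
      refine eig_g hA hc hlow (ν := ν) ?_ ?_
      · rw [map_sub, map_smul, map_smul, hw, hv2 i, smul_sub, smul_comm ν, smul_comm ν]
      · rw [inner_sub_left, inner_smul_left, inner_smul_left]
        simp only [Complex.conj_conj]
        ring
    have h3 := congrArg (fun t => ⟪t, x⟫_ℂ) hu
    simp only [inner_sub_left, inner_smul_left, Complex.conj_conj, hvx, mul_zero, sub_zero,
      inner_zero_left] at h3
    exact (mul_eq_zero.mp h3).resolve_left (hg i)
  have hI : Infinite Λ := by
    by_contra hfin
    rw [not_infinite_iff_finite] at hfin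
    have hfd : FiniteDimensional ℂ (Submodule.span ℂ (Set.range v)) :=
      FiniteDimensional.span_of_finite ℂ (Set.finite_range v)
    have htop := Submodule.orthogonal_eq_bot_iff.mp htot
    rw [htop] at hfd
    exact hinf (Module.Finite.equiv (Submodule.topEquiv (R := ℂ) (M := H)))
  have hCt : Countable Λ := by
    have hs := (horth.inner_products_summable g).countable_support
    have : Function.support (fun i => ‖⟪v i, g⟫_ℂ‖ ^ 2) = Set.univ := by
      ext i; simp [hg i]
    rw [this] at hs
    exact Set.countable_univ_iff.mp hs
  obtain ⟨hden⟩ := nonempty_denumerable Λ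
  let e : ℕ ≃ Λ := (Denumerable.eqv Λ).symm
  have ho2 : Orthonormal ℂ (v ∘ e) := horth.comp e e.injective
  have ht2 : (Submodule.span ℂ (Set.range (v ∘ e)))ᗮ = ⊥ := by
    rw [e.surjective.range_comp]; exact htot
  refine ⟨HilbertBasis.mkOfOrthogonalEqBot ho2 ht2, fun k => (e k).1,
    Subtype.val_injective.comp e.injective, fun k => ?_⟩
  rw [HilbertBasis.coe_mkOfOrthogonalEqBot]
  exact hv2 (e k)

lemma forward (hinf : ¬ FiniteDimensional ℂ H) {A : H →L[ℂ] H} (hA : IsStarNormal A) {g : H}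
    {c C : ℝ} (hc : 0 < c)
    (hfr : ∀ f : H, c * ‖f‖ ^ 2 ≤ ∑' n : ℕ, ‖⟪f, (A ^ n) g⟫_ℂ‖ ^ 2 ∧
        ∑' n : ℕ, ‖⟪f, (A ^ n) g⟫_ℂ‖ ^ 2 ≤ C * ‖f‖ ^ 2) (hcC : c ≤ C) :
    ∃ (b : HilbertBasis ℕ ℂ H) (lam : ℕ → ℂ),
      (∀ k : ℕ, A (b k) = lam k • b k) ∧
      (∀ k : ℕ, ‖lam k‖ < 1) ∧
      Filter.Tendsto (fun k : ℕ => ‖lam k‖) Filter.atTop (nhds 1) ∧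
      (∃ δ : ℝ, 0 < δ ∧ ∀ (n : ℕ) (S : Finset ℕ), n ∉ S →
        δ ≤ ∏ k ∈ S, ‖bl (lam k) (lam n)‖) ∧
      (∃ c' C' : ℝ, 0 < c' ∧ c' ≤ C' ∧ ∀ k : ℕ,
        c' ≤ ‖⟪(b k : H), g⟫_ℂ‖ / Real.sqrt (1 - ‖lam k‖ ^ 2) ∧
        ‖⟪(b k : H), g⟫_ℂ‖ / Real.sqrt (1 - ‖lam k‖ ^ 2) ≤ C') := by
  have hlow := fun f => (hfr f).1
  have hC0 : 0 < C := hc.trans_le hcC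
  obtain ⟨b, lam, hinj, hb⟩ := fr_basis hinf hA hc hlow
  have hb1 : ∀ k, ‖b k‖ = 1 := b.orthonormal.1
  have hbne : ∀ k, b k ≠ 0 := fun k h => by have := hb1 k; rw [h] at this; simp at this
  have hl : ∀ k, ‖lam k‖ < 1 := by
    intro k
    have ht := fr_tend hA hc hlow (b k)
    have e : ∀ n : ℕ, ‖(A ^ n) (b k)‖ = ‖lam k‖ ^ n := by
      intro n
      have : (A ^ n) (b k) = lam k ^ n • b k := by
        induction n with
        | zero => simp
        | succ n ih => rw [pow_succ', mul_apply_eq_comp, ih, map_smul, hb, smul_smul, pow_succ]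
      rw [this, norm_smul, hb1, mul_one, norm_pow]
    simp only [e] at ht
    have := tendsto_pow_atTop_nhds_zero_iff.mp ht
    rwa [abs_norm] at this
  have hw : ∀ k, 0 < 1 - ‖lam k‖ ^ 2 := fun k => by nlinarith [hl k, norm_nonneg (lam k)]
  have hg : ∀ k, ⟪b k, g⟫_ℂ ≠ 0 := fun k h => hbne k (eig_g hA hc hlow (hb k) h)
  have hv : ∀ k, c ≤ ‖⟪b k, g⟫_ℂ‖ ^ 2 / (1 - ‖lam k‖ ^ 2) ∧
      ‖⟪b k, g⟫_ℂ‖ ^ 2 / (1 - ‖lam k‖ ^ 2) ≤ C := by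
    intro k
    have h := hfr (b k)
    have hs : ∑' n : ℕ, ‖⟪b k, (A ^ n) g⟫_ℂ‖ ^ 2 = ‖⟪b k, g⟫_ℂ‖ ^ 2 / (1 - ‖lam k‖ ^ 2) := by
      have : ∀ n : ℕ, ‖⟪b k, (A ^ n) g⟫_ℂ‖ ^ 2 = (‖lam k‖ ^ 2) ^ n * ‖⟪b k, g⟫_ℂ‖ ^ 2 := by
        intro n
        rw [inner_pow_eig hA (hb k), norm_mul, norm_pow, mul_pow, pow_right_comm]
      simp only [this]
      rw [tsum_mul_right, tsum_geometric_of_lt_one (by positivity) (by linarith [hw k])]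
      rw [div_eq_inv_mul]
    rw [hs, hb1] at h
    simpa using h
  refine ⟨b, lam, hb, hl, ?_, ⟨Real.sqrt (c / C), Real.sqrt_pos.mpr (by positivity), ?_⟩,
    Real.sqrt c, Real.sqrt C, Real.sqrt_pos.mpr hc, Real.sqrt_le_sqrt hcC, ?_⟩
  · have hs := (b.orthonormal.inner_products_summable g).tendsto_atTop_zero.div_const c
    have h1 : Filter.Tendsto (fun k => 1 - ‖lam k‖ ^ 2) Filter.atTop (nhds 0) := by
      refine squeeze_zero (fun k => (hw k).le) (fun k => ?_) (by simpa using hs)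
      have := (hv k).1
      rw [le_div_iff₀ (hw k)] at this
      rw [le_div_iff₀ hc]
      linarith
    have h2 := (h1.const_sub 1).sqrt
    simpa using h2
  · intro n S hn
    obtain ⟨a, ha1, ha2⟩ := pf_En S hl hinj hn
    have hs := inner_sum_hasSum hA (b := b) hb hl g (insert n S)
      (fun k => a k / (starRingEnd ℂ) ⟪b k, g⟫_ℂ)
    have e : (fun k => a k / (starRingEnd ℂ) ⟪b k, g⟫_ℂ * (starRingEnd ℂ) ⟪b k, g⟫_ℂ) = a := by
      funext k
      exact div_mul_cancel₀ _ ((map_ne_zero (starRingEnd ℂ)).mpr (hg k))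
    simp only [e] at hs
    rw [ha2] at hs
    have h1 := hlow (∑ k ∈ insert n S, (a k / (starRingEnd ℂ) ⟪b k, g⟫_ℂ) • b k)
    rw [hs.tsum_eq, orth_norm_sq b.orthonormal] at h1
    have h2 : 1 / ‖⟪b n, g⟫_ℂ‖ ^ 2 ≤
        ∑ k ∈ insert n S, ‖a k / (starRingEnd ℂ) ⟪b k, g⟫_ℂ‖ ^ 2 := by
      refine le_trans (le_of_eq ?_) (Finset.single_le_sum
        (f := fun k => ‖a k / (starRingEnd ℂ) ⟪b k, g⟫_ℂ‖ ^ 2)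
        (fun _ _ => by positivity) (Finset.mem_insert_self n S))
      simp only [ha1, norm_div, RCLike.norm_conj, norm_one, div_pow, one_pow]
    have hgp : 0 < ‖⟪b n, g⟫_ℂ‖ ^ 2 := by have := norm_pos_iff.mpr (hg n); positivity
    have h3 := (mul_le_mul_of_nonneg_left h2 hc.le).trans h1
    rw [le_div_iff₀ (hw n)] at h3
    have h4 := (hv n).2
    rw [div_le_iff₀ (hw n)] at h4
    apply Real.sqrt_le_iff.mpr
    refine ⟨Finset.prod_nonneg fun _ _ => norm_nonneg _, le_trans ?_ h3⟩
    rw [div_le_iff₀ hC0, mul_one_div, div_mul_eq_mul_div, div_mul_eq_mul_div, le_div_iff₀ hgp]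
    nlinarith
  · intro k
    have e : ‖⟪b k, g⟫_ℂ‖ / Real.sqrt (1 - ‖lam k‖ ^ 2) =
        Real.sqrt (‖⟪b k, g⟫_ℂ‖ ^ 2 / (1 - ‖lam k‖ ^ 2)) := by
      rw [Real.sqrt_div (by positivity), Real.sqrt_sq (norm_nonneg _)]
    rw [e]
    exact ⟨Real.sqrt_le_sqrt (hv k).1, Real.sqrt_le_sqrt (hv k).2⟩

lemma bl_conv (z w : ℂ) : ‖z - w‖ / ‖1 - (starRingEnd ℂ) z * w‖ = ‖bl w z‖ := by
  rw [bl, norm_div]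
  congr 1
  rw [← RCLike.norm_conj (1 - (starRingEnd ℂ) z * w)]
  simp [mul_comm]

end


/-- Characterization of bounded normal operators `A` and single generators `g` on an
infinite-dimensional separable complex Hilbert space such that `{Aⁿ g : n ≥ 0}` is a frame:
`A` must diagonalize in an orthonormal basis `(e_k)` with eigenvalues `λ_k` satisfying
`|λ_k| < 1`, `|λ_k| → 1`, the Carleson condition, and the two-sided normalization condition
on `|⟨e_k, g⟩| / √(1 - |λ_k|²)`. -/
theorem iterated_frame_single_generator_characterization
    {H : Type*} [NormedAddCommGroup H] [InnerProductSpace ℂ H] [CompleteSpace H]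
    [TopologicalSpace.SeparableSpace H] (hinf : ¬ FiniteDimensional ℂ H)
    (A : H →L[ℂ] H) (hA : IsStarNormal A) (g : H) :
    (∃ c C : ℝ, 0 < c ∧ c ≤ C ∧ ∀ f : H,
        c * ‖f‖ ^ 2 ≤ ∑' n : ℕ, ‖⟪f, (A ^ n) g⟫_ℂ‖ ^ 2 ∧
        ∑' n : ℕ, ‖⟪f, (A ^ n) g⟫_ℂ‖ ^ 2 ≤ C * ‖f‖ ^ 2)
      ↔
    (∃ (b : HilbertBasis ℕ ℂ H) (lam : ℕ → ℂ),
      (∀ k : ℕ, A (b k) = lam k • b k) ∧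
      (∀ k : ℕ, ‖lam k‖ < 1) ∧
      Filter.Tendsto (fun k : ℕ => ‖lam k‖) Filter.atTop (nhds 1) ∧
      (∃ δ : ℝ, 0 < δ ∧ ∀ (n : ℕ) (S : Finset ℕ), n ∉ S →
        δ ≤ ∏ k ∈ S, ‖lam n - lam k‖ / ‖1 - (starRingEnd ℂ) (lam n) * lam k‖) ∧
      (∃ c' C' : ℝ, 0 < c' ∧ c' ≤ C' ∧ ∀ k : ℕ,
        c' ≤ ‖⟪(b k : H), g⟫_ℂ‖ / Real.sqrt (1 - ‖lam k‖ ^ 2) ∧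
        ‖⟪(b k : H), g⟫_ℂ‖ / Real.sqrt (1 - ‖lam k‖ ^ 2) ≤ C')) := by
  constructor
  · rintro ⟨c, C, hc, hcC, hfr⟩
    obtain ⟨b, lam, h1, h2, h3, ⟨δ, hδ, h4⟩, h5⟩ := forward hinf hA hc hfr hcC
    refine ⟨b, lam, h1, h2, h3, ⟨δ, hδ, fun n S hn => ?_⟩, h5⟩
    simpa only [bl_conv] using h4 n S hn
  · rintro ⟨b, lam, h1, h2, -, ⟨δ, hδ, h4⟩, c', C', hc', -, h5⟩
    simp only [bl_conv] at h4
    exact backward hA g b lam h1 h2 hδ h4 hc' h5
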